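/- Under the standing assumptions, let c be a codeword of C_{n−1}(n,q) with wt(c) ≤ W(n,q), let k satisfy 1 ≤ k ≤ n, and let κ be a k-space of PG(n,q) that is thin with respect to c. Write wt_κ for the number of points of supp(c) lying in κ, and suppose there exist at most ⌈wt_κ/θ_{k−1}⌉ pairwise distinct (k−1)-spaces contained in κ and nonzero scalars in ℤ/pℤ such that, at every point P lying in κ, c(P) equals the corresponding linear combination of indicator functions evaluated at P. Let m_κ := max{a ∈ ℕ : there exists a line l contained in κ such that exactly a points of supp(c) lie on l and a ≤ W(1,q)}. Then there exist exactly m_κ pairwise distinct (k−1)-spaces contained in κ and nonzero scalars in ℤ/pℤ whose linear combination of indicators agrees with c at every point of κ, and moreover wt_κ ≤ m_κ·q^(k−1) + θ_{k−2} ≤ Δ_{n,q}·q^(k−1) + θ_{k−2}. -/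

import Mathlib

open Module

noncomputable section

/-- `pgTheta q m = 1 + q + … + q^m` for `m ≥ 0`, and `0` for `m < 0`. -/
def pgTheta (q : ℕ) (m : ℤ) : ℤ := ∑ i ∈ Finset.range (m + 1).toNat, (q : ℤ) ^ i

/-- `q^j`, truncated to `0` for negative exponents `j`. -/
def pgQpow (q : ℕ) (j : ℤ) : ℤ := if j < 0 then 0 else (q : ℤ) ^ j.toNat

/-- `Δ_{i,q}` where `q = p^h`: `⌊√q / 2^(i-2)⌋` if `h > 2`, and `⌊p / 2^i⌋` if `h = 2`. -/
noncomputable def pgDelta (p h : ℕ) (i : ℤ) : ℤ :=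
  if 2 < h then ⌊Real.sqrt ((p : ℝ) ^ h) / (2 : ℝ) ^ (i - 2)⌋
  else ⌊(p : ℝ) / (2 : ℝ) ^ i⌋

/-- `W(i,q) = (Δ_{i,q} - 1)·θ_{i-1}`. -/
noncomputable def pgW (p h : ℕ) (i : ℤ) : ℤ := (pgDelta p h i - 1) * pgTheta (p ^ h) (i - 1)

/-- `U(n,i,q) = q^i − (Δ_{n,q} − 2)·⌊q^(i−1)⌋ − (i−2)·((q−1)·Δ_{n,q} + 1)·⌊q^(i−3)⌋ + θ_{i−3}`. -/
noncomputable def pgU (p h n : ℕ) (i : ℤ) : ℤ :=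
  pgQpow (p ^ h) i - (pgDelta p h n - 2) * pgQpow (p ^ h) (i - 1)
    - (i - 2) * ((((p ^ h : ℕ) : ℤ) - 1) * pgDelta p h n + 1) * pgQpow (p ^ h) (i - 3)
    + pgTheta (p ^ h) (i - 3)

/-- `⌈w / θ_m⌉` as a natural number. -/
noncomputable def pgCeil (q w : ℕ) (m : ℤ) : ℕ := (⌈(w : ℚ) / ((pgTheta q m : ℤ) : ℚ)⌉).toNat
open scoped Classical

/-- A point of `PG(n,q)`: a 1-dimensional subspace of `F^(n+1)`. -/
abbrev PGPoint (F : Type) [Field F] (n : ℕ) :=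
  {P : Submodule F (Fin (n + 1) → F) // finrank F P = 1}

/-- The indicator function of a subspace `κ`, with values in `ZMod p`. -/
noncomputable def pgInd (p : ℕ) (F : Type) [Field F] (n : ℕ)
    (κ : Submodule F (Fin (n + 1) → F)) : PGPoint F n → ZMod p :=
  fun P => if P.1 ≤ κ then 1 else 0

/-- The code `C_{n-1}(n,q)`: the `ZMod p`-span of the indicator functions of all
hyperplanes (i.e. `n`-dimensional subspaces of `F^(n+1)`). -/
noncomputable def pgCode (p : ℕ) (F : Type) [Field F] (n : ℕ) :
    Submodule (ZMod p) (PGPoint F n → ZMod p) :=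
  Submodule.span (ZMod p)
    {f | ∃ H : Submodule F (Fin (n + 1) → F), finrank F H = n ∧ f = pgInd p F n H}

/-- The weight of a codeword: the number of points where it is nonzero. -/
noncomputable def pgWt (p : ℕ) (F : Type) [Field F] (n : ℕ)
    (c : PGPoint F n → ZMod p) : ℕ :=
  Set.ncard {P : PGPoint F n | c P ≠ 0}

/-- The number of points of `supp c` lying in the subspace `κ`. -/
noncomputable def pgSecant (p : ℕ) (F : Type) [Field F] (n : ℕ)
    (c : PGPoint F n → ZMod p) (κ : Submodule F (Fin (n + 1) → F)) : ℕ :=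
  Set.ncard {P : PGPoint F n | c P ≠ 0 ∧ P.1 ≤ κ}

/-- A codeword `c` is minimal if every codeword whose support is contained in the
support of `c` is a scalar multiple of `c`. -/
noncomputable def pgMinimal (p : ℕ) (F : Type) [Field F] (n : ℕ)
    (c : PGPoint F n → ZMod p) : Prop :=
  ∀ c' ∈ pgCode p F n, {P : PGPoint F n | c' P ≠ 0} ⊆ {P : PGPoint F n | c P ≠ 0} →
    ∃ α : ZMod p, c' = α • c

/-- The Hankel matrix `(M (i + j))` of size `s`. -/
def hankel {R : Type*} (s : ℕ) (M : ℕ → R) : Matrix (Fin s) (Fin s) R :=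
  Matrix.of fun i j => M (i + j)

lemma natDegree_det_hankel_le {F : Type*} [Field F] {s : ℕ} {M : ℕ → Polynomial F}
    (hM : ∀ j ≤ 2 * s - 2, (M j).natDegree ≤ j) :
    (hankel s M).det.natDegree ≤ s * (s - 1) := by
  rw [Matrix.det_apply]
  refine Polynomial.natDegree_sum_le_of_forall_le _ _ fun σ _ => ?_
  refine (Polynomial.natDegree_smul_le _ _).trans ?_
  refine (Polynomial.natDegree_prod_le _ _).trans ?_
  calc ∑ i, (hankel s M (σ i) i).natDegree ≤ ∑ i : Fin s, ((σ i : ℕ) + (i : ℕ)) :=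
        Finset.sum_le_sum fun i _ => hM _ (by have := (σ i).2; have := i.2; omega)
    _ = s * (s - 1) := by
        rw [Finset.sum_add_distrib, Equiv.sum_comp σ fun i : Fin s => (i : ℕ),
          Fin.sum_univ_eq_sum_range (fun i => i), ← mul_two, Finset.sum_range_id_mul_two]

lemma det_hankel_moments_ne_zero {F : Type*} [Field F] [Fintype F] (w : F → F) {s : ℕ}
    (hs : (Finset.univ.filter fun x => w x ≠ 0).card = s) :
    (hankel s fun j => ∑ x, w x * x ^ j).det ≠ 0 := by
  classical
  obtain ⟨e⟩ : Nonempty (Fin s ≃ {x // x ∈ Finset.univ.filter fun x => w x ≠ 0}) :=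
    ⟨(Finset.equivFinOfCardEq hs).symm⟩
  have key : hankel s (fun j => ∑ x, w x * x ^ j) =
      (Matrix.vandermonde fun i => (e i : F)).transpose *
        (Matrix.diagonal (fun i => w (e i)) * Matrix.vandermonde fun i => (e i : F)) := by
    ext i j
    rw [Matrix.mul_apply]
    simp only [hankel, Matrix.of_apply, Matrix.transpose_apply, Matrix.diagonal_mul,
      Matrix.vandermonde_apply]
    rw [e.sum_comp fun x => (x : F) ^ (i : ℕ) * (w x * (x : F) ^ (j : ℕ)),
      Finset.sum_coe_sort (Finset.univ.filter fun x => w x ≠ 0)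
        fun x => x ^ (i : ℕ) * (w x * x ^ (j : ℕ)), Finset.sum_filter_of_ne]
    · exact Finset.sum_congr rfl fun x _ => by ring
    · intro x _ hx h0
      simp [h0] at hx
  rw [key, Matrix.det_mul, Matrix.det_mul, Matrix.det_transpose, Matrix.det_diagonal]
  have hV : (Matrix.vandermonde fun i => (e i : F)).det ≠ 0 :=
    Matrix.det_vandermonde_ne_zero_iff.2 fun i j hij => e.injective (Subtype.ext hij)
  refine mul_ne_zero hV (mul_ne_zero (Finset.prod_ne_zero_iff.2 fun i _ => ?_) hV)
  exact (Finset.mem_filter.1 (e i).2).2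

lemma X_sub_C_pow_dvd_det_hankel {F : Type*} [Field F] [Fintype F] (w : F → F) {s : ℕ}
    {M : ℕ → Polynomial F} {t : F}
    (hM : ∀ j ≤ 2 * s - 2, (M j).eval t = ∑ x, w x * x ^ j) :
    (Polynomial.X - Polynomial.C t) ^ (s - (Finset.univ.filter fun x => w x ≠ 0).card) ∣
      (hankel s M).det := by
  classical
  set S := Finset.univ.filter fun x => w x ≠ 0 with hS
  set g : Polynomial F := ∏ x ∈ S, (Polynomial.X - Polynomial.C x) with hg
  have hgm : g.Monic := Polynomial.monic_prod_of_monic _ _ fun x _ => Polynomial.monic_X_sub_C x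
  have hgd : g.natDegree = S.card := by
    rw [hg, Polynomial.natDegree_prod_of_monic _ _ fun x _ => Polynomial.monic_X_sub_C x]
    simp
  set P : Matrix (Fin s) (Fin s) F := Matrix.of fun i k =>
    if (i : ℕ) < S.card then (if i = k then 1 else 0)
    else (g * Polynomial.X ^ ((i : ℕ) - S.card)).coeff k with hP
  have hdeg : ∀ i : Fin s, S.card ≤ (i : ℕ) →
      (g * Polynomial.X ^ ((i : ℕ) - S.card)).natDegree = (i : ℕ) := fun i hi => by
    rw [hgm.natDegree_mul (Polynomial.monic_X_pow _), hgd, Polynomial.natDegree_X_pow]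
    omega
  have hPdet : P.det = 1 := by
    rw [Matrix.det_of_isLowerTriangular P]
    · refine Finset.prod_eq_one fun i _ => ?_
      simp only [hP, Matrix.of_apply]
      split_ifs with h
      · rfl
      · have h1 := (hgm.mul (Polynomial.monic_X_pow ((i : ℕ) - S.card))).coeff_natDegree
        rwa [hdeg i (by omega)] at h1
    · intro i k hik
      have hik' : (i : ℕ) < k := hik
      simp only [hP, Matrix.of_apply]
      split_ifs with h h2
      · omega
      · rfl
      · exact Polynomial.coeff_eq_zero_of_natDegree_lt (by rw [hdeg i (by omega)]; exact hik')
  have hrow : ∀ i j : Fin s, S.card ≤ (i : ℕ) →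
      (Polynomial.X - Polynomial.C t) ∣ (P.map Polynomial.C * hankel s M) i j := by
    intro i j hi
    rw [Polynomial.dvd_iff_isRoot, Polynomial.IsRoot, Matrix.mul_apply,
      Polynomial.eval_finsetSum]
    have h1 : ∀ k : Fin s, (P.map Polynomial.C i k * hankel s M k j).eval t =
        ∑ x, w x * x ^ (j : ℕ) *
          ((g * Polynomial.X ^ ((i : ℕ) - S.card)).coeff k * x ^ (k : ℕ)) := fun k => by
      have : (hankel s M k j).eval t = ∑ x, w x * x ^ ((k : ℕ) + j) :=
        hM _ (by have := k.2; have := j.2; omega)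
      rw [Polynomial.eval_mul, this, Matrix.map_apply, Polynomial.eval_C, Finset.mul_sum]
      refine Finset.sum_congr rfl fun x _ => ?_
      simp only [hP, Matrix.of_apply, if_neg (not_lt.2 hi)]
      ring
    rw [Finset.sum_congr rfl fun k _ => h1 k, Finset.sum_comm]
    refine Finset.sum_eq_zero fun x _ => ?_
    have heval : ∑ k : Fin s, (g * Polynomial.X ^ ((i : ℕ) - S.card)).coeff k * x ^ (k : ℕ) =
        (g * Polynomial.X ^ ((i : ℕ) - S.card)).eval x := by
      rw [Polynomial.eval_eq_sum_range' (n := s) (by rw [hdeg i hi]; exact i.2),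
        Finset.sum_range]
    rw [← Finset.mul_sum, heval]
    by_cases hx : w x = 0
    · simp [hx]
    · have : g.eval x = 0 := by
        rw [hg, Polynomial.eval_prod]
        exact Finset.prod_eq_zero (i := x) (by simp [hS, hx]) (by simp)
      simp [this]
  have hdet : (hankel s M).det = (P.map Polynomial.C * hankel s M).det := by
    have := RingHom.map_det (Polynomial.C : F →+* Polynomial F) P
    rw [Matrix.det_mul, show P.map Polynomial.C = Polynomial.C.mapMatrix P from rfl, ← this,
      hPdet]
    simp
  have hfac : ∀ i j : Fin s, ∃ b, (P.map Polynomial.C * hankel s M) i j =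
      (if (i : ℕ) < S.card then 1 else Polynomial.X - Polynomial.C t) * b := fun i j => by
    split_ifs with h
    · exact ⟨_, (one_mul _).symm⟩
    · exact hrow i j (by omega)
  choose B hB using hfac
  have hmat : P.map Polynomial.C * hankel s M = Matrix.of fun i j : Fin s =>
      (if (i : ℕ) < S.card then 1 else Polynomial.X - Polynomial.C t) * Matrix.of B i j :=
    Matrix.ext hB
  rw [hdet, hmat, Matrix.det_mul_column]
  refine Dvd.dvd.mul_right ?_ _
  rw [Finset.prod_ite, Finset.prod_const_one, one_mul, Finset.prod_const]
  refine pow_dvd_pow _ ?_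
  have h1 : (Finset.univ.filter fun i : Fin s => (i : ℕ) < S.card).card ≤ S.card := by
    have : ((Finset.univ.filter fun i : Fin s => (i : ℕ) < S.card).image Fin.val).card ≤
        (Finset.range S.card).card := Finset.card_le_card fun a ha => by
      obtain ⟨i, hi, rfl⟩ := Finset.mem_image.1 ha
      simpa using hi
    rwa [Finset.card_image_of_injective _ Fin.val_injective, Finset.card_range] at this
  have h2 := Finset.card_filter_add_card_filter_not (s := Finset.univ)
    (fun i : Fin s => (i : ℕ) < S.card)
  rw [Finset.card_univ, Fintype.card_fin] at h2
  omega

/-- If the power moments of the functions `f · t` are polynomials in `t` of degree at most their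
order, then the supports of these functions are rarely smaller than a given one. -/
lemma sum_tsub_card_support_le {F : Type*} [Field F] [Fintype F] (f : F → F → F) (s : ℕ)
    (M : ℕ → Polynomial F) (hdeg : ∀ j ≤ 2 * s - 2, (M j).natDegree ≤ j)
    (hM : ∀ j ≤ 2 * s - 2, ∀ t, (M j).eval t = ∑ x, f t x * x ^ j) (t₀ : F)
    (ht₀ : (Finset.univ.filter fun x => f t₀ x ≠ 0).card = s) :
    ∑ t, (s - (Finset.univ.filter fun x => f t x ≠ 0).card) ≤ s * (s - 1) := by
  classical
  have hne : (hankel s M).det ≠ 0 := fun h0 => by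
    refine det_hankel_moments_ne_zero (f t₀) ht₀ ?_
    have h1 := RingHom.map_det (Polynomial.evalRingHom t₀) (hankel s M)
    rw [h0, map_zero] at h1
    rw [h1]
    congr 1
    ext i j
    exact (hM _ (by have := i.2; have := j.2; omega) t₀).symm
  have hdvd : ∏ t, (Polynomial.X - Polynomial.C t) ^
      (s - (Finset.univ.filter fun x => f t x ≠ 0).card) ∣ (hankel s M).det :=
    Finset.prod_dvd_of_coprime
      (fun a _ b _ hab => (Polynomial.pairwise_coprime_X_sub_C Function.injective_id hab).pow)
      fun t _ => X_sub_C_pow_dvd_det_hankel (f t) fun j hj => hM j hj t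
  have h2 := (Polynomial.natDegree_le_of_dvd hdvd hne).trans (natDegree_det_hankel_le hdeg)
  rw [Polynomial.natDegree_prod_of_monic _ _ fun t _ => (Polynomial.monic_X_sub_C t).pow _] at h2
  simpa using h2

/-- The value of `c` at the point spanned by `v`, and `0` for `v = 0`. -/
def pgEval {p : ℕ} {F : Type} [Field F] {n : ℕ} (c : PGPoint F n → ZMod p)
    (v : Fin (n + 1) → F) : ZMod p :=
  if h : v ≠ 0 then c ⟨Submodule.span F {v}, finrank_span_singleton h⟩ else 0

section pgEval

variable {p : ℕ} {F : Type} [Field F] {n : ℕ}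

lemma pgPoint_eq_span {P : PGPoint F n} {v : Fin (n + 1) → F} (hv : v ≠ 0) (hvP : v ∈ P.1) :
    P = ⟨Submodule.span F {v}, finrank_span_singleton hv⟩ := by
  refine Subtype.ext (Submodule.eq_of_le_of_finrank_eq ?_ ?_).symm
  · rwa [Submodule.span_singleton_le_iff_mem]
  · rw [P.2, finrank_span_singleton hv]

lemma pgEval_eq (c : PGPoint F n → ZMod p) {P : PGPoint F n} {v : Fin (n + 1) → F}
    (hv : v ≠ 0) (hvP : v ∈ P.1) : pgEval c v = c P := by
  rw [pgEval, dif_pos hv, pgPoint_eq_span hv hvP]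

lemma pgPoint_exists_vector (P : PGPoint F n) : ∃ v ∈ P.1, v ≠ 0 := by
  refine Submodule.exists_mem_ne_zero_of_ne_bot fun h => ?_
  have := P.2
  rw [h, finrank_bot] at this
  omega

lemma pgPoint_le_iff {P : PGPoint F n} {κ : Submodule F (Fin (n + 1) → F)}
    {v : Fin (n + 1) → F} (hv : v ≠ 0) (hvP : v ∈ P.1) : P.1 ≤ κ ↔ v ∈ κ := by
  rw [pgPoint_eq_span hv hvP, Submodule.span_singleton_le_iff_mem]

@[simp] lemma pgEval_zero_right (c : PGPoint F n → ZMod p) : pgEval c 0 = 0 := by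
  simp [pgEval]

lemma pgEval_smul_right (c : PGPoint F n → ZMod p) {a : F} (ha : a ≠ 0)
    (v : Fin (n + 1) → F) : pgEval c (a • v) = pgEval c v := by
  by_cases hv : v = 0
  · simp [hv]
  · rw [pgEval_eq c hv (P := ⟨Submodule.span F {v}, finrank_span_singleton hv⟩)
      (Submodule.mem_span_singleton_self v),
      pgEval_eq c (smul_ne_zero ha hv) (P := ⟨Submodule.span F {v}, finrank_span_singleton hv⟩)
      (Submodule.smul_mem _ _ (Submodule.mem_span_singleton_self v))]

lemma pgEval_pgInd (κ : Submodule F (Fin (n + 1) → F)) {v : Fin (n + 1) → F} (hv : v ≠ 0) :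
    pgEval (pgInd p F n κ) v = if v ∈ κ then 1 else 0 := by
  simp only [pgEval, dif_pos hv, pgInd, Submodule.span_singleton_le_iff_mem]

lemma pgEval_add (c d : PGPoint F n → ZMod p) (v : Fin (n + 1) → F) :
    pgEval (c + d) v = pgEval c v + pgEval d v := by
  by_cases hv : v = 0 <;> simp [pgEval, hv]

lemma pgEval_smul (a : ZMod p) (c : PGPoint F n → ZMod p) (v : Fin (n + 1) → F) :
    pgEval (a • c) v = a * pgEval c v := by
  by_cases hv : v = 0 <;> simp [pgEval, hv]

lemma pgEval_zero (v : Fin (n + 1) → F) : pgEval (0 : PGPoint F n → ZMod p) v = 0 := by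
  by_cases hv : v = 0 <;> simp [pgEval, hv]

variable [Fintype F]

lemma card_filter_mem (S : Submodule F (Fin (n + 1) → F)) :
    (Finset.univ.filter (· ∈ S)).card = Fintype.card F ^ finrank F S := by
  rw [← Module.card_eq_pow_finrank (K := F) (V := S), Fintype.card_subtype]

lemma card_filter_mem_ne_zero (S : Submodule F (Fin (n + 1) → F)) :
    (Finset.univ.filter fun v => v ∈ S ∧ v ≠ 0).card = Fintype.card F ^ finrank F S - 1 := by
  rw [← card_filter_mem, ← Finset.card_erase_of_mem (a := 0) (by simp)]
  congr 1
  ext v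
  simp [and_comm]

/-- Every point is spanned by `q - 1` vectors. -/
lemma pgSecant_mul_card_sub_one (c : PGPoint F n → ZMod p)
    (κ : Submodule F (Fin (n + 1) → F)) :
    pgSecant p F n c κ * (Fintype.card F - 1) =
      (Finset.univ.filter fun v => v ∈ κ ∧ pgEval c v ≠ 0).card := by
  set A : Finset (PGPoint F n) := (Set.toFinite {P : PGPoint F n | c P ≠ 0 ∧ P.1 ≤ κ}).toFinset
    with hA
  have hmem : ∀ P, P ∈ A ↔ c P ≠ 0 ∧ P.1 ≤ κ := fun P => by simp [hA]
  have hcard : pgSecant p F n c κ = A.card := Set.ncard_eq_toFinset_card _ _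
  have hU : (Finset.univ.filter fun v => v ∈ κ ∧ pgEval c v ≠ 0) =
      A.biUnion fun P => Finset.univ.filter fun v => v ∈ P.1 ∧ v ≠ 0 := by
    ext v
    simp only [Finset.mem_filter, Finset.mem_univ, true_and, Finset.mem_biUnion, hmem]
    constructor
    · rintro ⟨hv, hcv⟩
      have hv0 : v ≠ 0 := by rintro rfl; simp at hcv
      have hself := Submodule.mem_span_singleton_self (R := F) v
      refine ⟨⟨Submodule.span F {v}, finrank_span_singleton hv0⟩, ⟨?_, ?_⟩, hself, hv0⟩
      · rwa [← pgEval_eq c hv0 hself]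
      · rwa [pgPoint_le_iff hv0 hself]
    · rintro ⟨P, ⟨hc, hP⟩, hvP, hv0⟩
      exact ⟨hP hvP, by rwa [pgEval_eq c hv0 hvP]⟩
  rw [hU, Finset.card_biUnion, Finset.sum_congr rfl fun P _ => card_filter_mem_ne_zero P.1, hcard]
  · rw [Finset.sum_congr rfl fun P _ => by rw [P.2, pow_one], Finset.sum_const, smul_eq_mul]
  · intro P _ Q _ hPQ
    refine Finset.disjoint_left.2 fun v hv hv' => hPQ ?_
    simp only [Finset.mem_filter, Finset.mem_univ, true_and] at hv hv'
    rw [pgPoint_eq_span hv.2 hv.1, pgPoint_eq_span hv'.2 hv'.1]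

/-- On an affine plane, the power moments of a codeword along a parallel class of lines are
polynomial functions of low degree. -/
lemma exists_moment_polynomial (σ : ZMod p →+* F) {c : PGPoint F n → ZMod p}
    (hc : c ∈ pgCode p F n) {r u w : Fin (n + 1) → F}
    (hne : ∀ x t : F, x • r + u + t • w ≠ 0) {j : ℕ} (hj : j < Fintype.card F - 1) :
    ∃ M : Polynomial F, M.natDegree ≤ j ∧
      ∀ t, M.eval t = ∑ x, σ (pgEval c (x • r + u + t • w)) * x ^ j := by
  induction hc using Submodule.span_induction with
  | mem f hf =>
    obtain ⟨H, hH, rfl⟩ := hf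
    simp only [pgEval_pgInd H (hne _ _)]
    by_cases hr : r ∈ H
    · refine ⟨0, by simp, fun t => ?_⟩
      have : ∀ x, (x • r + u + t • w ∈ H) ↔ (u + t • w ∈ H) := fun x => by
        rw [add_assoc]
        exact Submodule.add_mem_iff_right _ (H.smul_mem x hr)
      simp only [this, ← Finset.mul_sum, FiniteField.sum_pow_lt_card_sub_one F j hj]
      simp
    · have htop : H ⊔ Submodule.span F {r} = ⊤ := by
        refine Submodule.eq_top_of_finrank_eq (le_antisymm (Submodule.finrank_le _) ?_)
        rw [finrank_fin_fun]
        refine Nat.succ_le_of_lt (hH.symm.trans_lt ?_)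
        refine Submodule.finrank_lt_finrank_of_lt (lt_of_le_of_ne le_sup_left fun h => hr ?_)
        rw [h]
        exact Submodule.mem_sup_right (Submodule.mem_span_singleton_self r)
      have hdec : ∀ v : Fin (n + 1) → F, ∃ a : F, v - a • r ∈ H := fun v => by
        obtain ⟨y, hy, z, hz, rfl⟩ := Submodule.mem_sup.1 (htop ▸ Submodule.mem_top (x := v))
        obtain ⟨a, rfl⟩ := Submodule.mem_span_singleton.1 hz
        exact ⟨a, by simpa using hy⟩
      obtain ⟨a, ha⟩ := hdec u
      obtain ⟨b, hb⟩ := hdec w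
      have hiff : ∀ x t : F, x • r + u + t • w ∈ H ↔ x = -(a + t * b) := fun x t => by
        have h1 : x • r + u + t • w =
            (x + (a + t * b)) • r + ((u - a • r) + t • (w - b • r)) := by module
        rw [h1, Submodule.add_mem_iff_left _ (H.add_mem ha (H.smul_mem t hb)),
          ← add_eq_zero_iff_eq_neg]
        exact ⟨fun h => by_contra fun h0 => hr ((H.smul_mem_iff h0).1 h),
          fun h => by simp [h]⟩
      refine ⟨(-(Polynomial.C a + Polynomial.C b * Polynomial.X)) ^ j, ?_, fun t => ?_⟩
      · refine Polynomial.natDegree_pow_le.trans (mul_le_of_le_one_right j.zero_le ?_)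
        rw [Polynomial.natDegree_neg]
        refine Polynomial.natDegree_add_le_of_degree_le (by simp) ?_
        exact (Polynomial.natDegree_C_mul_le _ _).trans Polynomial.natDegree_X_le
      · simp only [hiff]
        simp [mul_comm b t]
  | zero => exact ⟨0, by simp, fun t => by simp [pgEval_zero]⟩
  | add f g _ _ hf hg =>
    obtain ⟨M, hM, hM'⟩ := hf
    obtain ⟨N, hN, hN'⟩ := hg
    refine ⟨M + N, Polynomial.natDegree_add_le_of_degree_le hM hN, fun t => ?_⟩
    simp only [Polynomial.eval_add, hM', hN', pgEval_add, map_add, add_mul,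
      Finset.sum_add_distrib]
  | smul a f _ hf =>
    obtain ⟨M, hM, hM'⟩ := hf
    refine ⟨Polynomial.C (σ a) * M, (Polynomial.natDegree_C_mul_le _ _).trans hM, fun t => ?_⟩
    simp only [Polynomial.eval_mul, Polynomial.eval_C, hM', pgEval_smul, map_mul, mul_assoc,
      Finset.mul_sum]

lemma card_sub_one_mul_le_sum_erase_zero [DecidableEq F] {W : Type*} [AddCommGroup W]
    [Module F W] [Fintype W] [DecidableEq W]
    (N : W → ℤ) (A : ℤ) (hA : ∀ w ≠ 0, A ≤ ∑ t ∈ Finset.univ.erase (0 : F), N (t • w)) :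
    ((Fintype.card W : ℤ) - 1) * A ≤
      ((Fintype.card F : ℤ) - 1) * ∑ w ∈ Finset.univ.erase (0 : W), N w := by
  have hcardW : ((Finset.univ.erase (0 : W)).card : ℤ) = (Fintype.card W : ℤ) - 1 := by
    rw [Finset.card_erase_of_mem (Finset.mem_univ _), Finset.card_univ,
      Nat.cast_sub Fintype.card_pos, Nat.cast_one]
  have hcardF : ((Finset.univ.erase (0 : F)).card : ℤ) = (Fintype.card F : ℤ) - 1 := by
    rw [Finset.card_erase_of_mem (Finset.mem_univ _), Finset.card_univ,
      Nat.cast_sub Fintype.card_pos, Nat.cast_one]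
  calc ((Fintype.card W : ℤ) - 1) * A = ∑ w ∈ Finset.univ.erase (0 : W), A := by
        rw [Finset.sum_const, nsmul_eq_mul, hcardW]
    _ ≤ ∑ w ∈ Finset.univ.erase (0 : W), ∑ t ∈ Finset.univ.erase (0 : F), N (t • w) :=
        Finset.sum_le_sum fun w hw => hA w (Finset.ne_of_mem_erase hw)
    _ = ∑ t ∈ Finset.univ.erase (0 : F), ∑ w ∈ Finset.univ.erase (0 : W), N w := by
        rw [Finset.sum_comm]
        refine Finset.sum_congr rfl fun t ht => ?_
        have ht0 : t ≠ 0 := Finset.ne_of_mem_erase ht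
        refine Finset.sum_nbij' (fun w => t • w) (fun w => t⁻¹ • w) ?_ ?_ ?_ ?_ ?_ <;>
          simp [ht0]
    _ = _ := by rw [Finset.sum_const, nsmul_eq_mul, hcardF]

/-- A line that is not contained in the support has a basis starting with a vector off the support,
which extends to a decomposition of the whole space. -/
lemma exists_frame_of_line {c : PGPoint F n → ZMod p} {l : Submodule F (Fin (n + 1) → F)}
    (hl : finrank F l = 2) (hs : pgSecant p F n c l ≤ Fintype.card F) :
    ∃ (r u : Fin (n + 1) → F) (W : Submodule F (Fin (n + 1) → F)), pgEval c r = 0 ∧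
      (∀ v, v ∈ l ↔ ∃ a b : F, a • r + b • u = v) ∧ finrank F W + 2 = n + 1 ∧
      ∀ (a b : F), ∀ w ∈ W, a • r + b • u + w = 0 → a = 0 ∧ b = 0 ∧ w = 0 := by
  have hq : 1 < Fintype.card F := Fintype.one_lt_card
  obtain ⟨r, hrl, hr0, hr⟩ : ∃ r ∈ l, r ≠ 0 ∧ pgEval c r = 0 := by
    by_contra! h
    have h1 : (Finset.univ.filter fun v => v ∈ l ∧ v ≠ 0).card ≤
        (Finset.univ.filter fun v => v ∈ l ∧ pgEval c v ≠ 0).card :=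
      Finset.card_le_card fun v hv => by
        simp only [Finset.mem_filter, Finset.mem_univ, true_and] at hv ⊢
        exact ⟨hv.1, h v hv.1 hv.2⟩
    rw [card_filter_mem_ne_zero, hl, ← pgSecant_mul_card_sub_one] at h1
    have h2 := h1.trans (Nat.mul_le_mul_right _ hs)
    obtain ⟨k, hk⟩ := Nat.exists_eq_add_of_lt hq
    rw [hk] at h2
    have : (1 + k + 1) ^ 2 - 1 = (1 + k + 1) * (1 + k + 1 - 1) + (1 + k) := by
      rw [Nat.add_sub_cancel, Nat.sub_eq_iff_eq_add (Nat.one_le_pow _ _ (by omega))]; ring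
    omega
  obtain ⟨u, hul, hu⟩ : ∃ u ∈ l, u ∉ Submodule.span F {r} := by
    by_contra! h
    have := Submodule.finrank_mono (show l ≤ Submodule.span F {r} from h)
    rw [hl, finrank_span_singleton hr0] at this
    omega
  have hru : ∀ a b : F, a • r + b • u = 0 → a = 0 ∧ b = 0 := fun a b hab => by
    have hb : b = 0 := by
      by_contra hb
      refine hu (((Submodule.span F {r}).smul_mem_iff hb).1 ?_)
      rw [← neg_eq_of_add_eq_zero_right hab]
      exact neg_mem (Submodule.smul_mem _ _ (Submodule.mem_span_singleton_self r))
    subst hb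
    simpa [hr0] using hab
  have hind : LinearIndependent F ![r, u] := LinearIndependent.pair_iff.2 hru
  have hspan : Submodule.span F {r, u} = l := by
    refine Submodule.eq_of_le_of_finrank_eq ?_ ?_
    · rw [Submodule.span_le, Set.insert_subset_iff, Set.singleton_subset_iff]
      exact ⟨hrl, hul⟩
    · rw [hl, ← Matrix.range_cons_cons_empty, finrank_span_eq_card hind, Fintype.card_fin]
  obtain ⟨W, hW⟩ := l.exists_isCompl
  refine ⟨r, u, W, hr, fun v => ?_, ?_, fun a b w hw h => ?_⟩
  · rw [← hspan, Submodule.mem_span_pair]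
  · have := Submodule.finrank_add_eq_of_isCompl hW
    rw [hl, finrank_fin_fun] at this
    omega
  · have hv : a • r + b • u ∈ l := l.add_mem (l.smul_mem _ hrl) (l.smul_mem _ hul)
    have hw0 : w = 0 := by
      refine Submodule.disjoint_def.1 hW.disjoint w ?_ hw
      rw [← neg_eq_of_add_eq_zero_right h]
      exact neg_mem hv
    subst hw0
    rw [add_zero] at h
    exact ⟨(hru a b h).1, (hru a b h).2, rfl⟩

/-- A line with few support points forces a large weight. -/
lemma le_pgWt_of_line {σ : ZMod p →+* F} (hσinj : Function.Injective σ)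
    {c : PGPoint F n → ZMod p} (hc : c ∈ pgCode p F n)
    {l : Submodule F (Fin (n + 1) → F)} (hl : finrank F l = 2)
    (hs : 2 * pgSecant p F n c l ≤ Fintype.card F) :
    ((Fintype.card F : ℤ) - 1) * pgSecant p F n c l + ((Fintype.card F : ℤ) ^ (n - 1) - 1) *
        (pgSecant p F n c l * (Fintype.card F - pgSecant p F n c l)) ≤
      ((Fintype.card F : ℤ) - 1) * pgWt p F n c := by
  have hq : 1 < Fintype.card F := Fintype.one_lt_card
  obtain ⟨r, u, W, hr, hl', hW, hind⟩ :=
    exists_frame_of_line (c := c) hl (by omega)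
  set s := pgSecant p F n c l with hs_def
  have hne : ∀ x : F, ∀ w ∈ W, x • r + u + w ≠ 0 := fun x w hw h => by
    have := hind x 1 w hw (by rw [one_smul]; exact h)
    exact one_ne_zero this.2.1
  have hinj : ∀ x x' : F, ∀ w ∈ W, ∀ w' ∈ W, ∀ P : PGPoint F n, x • r + u + w ∈ P.1 →
      x' • r + u + w' ∈ P.1 → x = x' ∧ w = w' := fun x x' w hw w' hw' P hP hP' => by
    rw [pgPoint_eq_span (hne x w hw) hP] at hP'
    obtain ⟨a, ha⟩ := Submodule.mem_span_singleton.1 hP'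
    have h0 := hind (a * x - x') (a - 1) (a • w - w') (W.sub_mem (W.smul_mem a hw) hw')
      (by rw [← sub_eq_zero] at ha; rw [← ha]; module)
    obtain rfl : a = 1 := sub_eq_zero.1 h0.2.1
    refine ⟨?_, ?_⟩
    · simpa [sub_eq_zero] using h0.1
    · simpa [sub_eq_zero] using h0.2.2
  set N : W → ℕ := fun w => (Finset.univ.filter fun x : F =>
    pgEval c (x • r + u + (w : Fin (n + 1) → F)) ≠ 0).card with hN
  let pt : F × W → PGPoint F n := fun y =>
    ⟨Submodule.span F {y.1 • r + u + (y.2 : Fin (n + 1) → F)},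
      finrank_span_singleton (hne y.1 y.2 y.2.2)⟩
  have hself : ∀ y : F × W, y.1 • r + u + (y.2 : Fin (n + 1) → F) ∈ (pt y).1 := fun y =>
    Submodule.mem_span_singleton_self _
  have hpt : ∀ y, c (pt y) = pgEval c (y.1 • r + u + (y.2 : Fin (n + 1) → F)) := fun y =>
    (pgEval_eq c (hne y.1 y.2 y.2.2) (hself y)).symm
  have hptinj : Function.Injective pt := fun y y' hyy => by
    have := hinj y.1 y'.1 y.2 y.2.2 y'.2 y'.2.2 (pt y) (hself y) (hyy ▸ hself y')
    exact Prod.ext this.1 (Subtype.ext this.2)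
  have hsum : ∑ w, N w ≤ pgWt p F n c := by
    have h1 : ∑ w, N w = (Finset.univ.filter fun y : F × W => c (pt y) ≠ 0).card := by
      simp only [hN, Finset.card_filter, hpt]
      rw [Fintype.sum_prod_type_right]
    rw [h1, ← Set.ncard_coe_finset, ← Set.ncard_image_of_injective _ hptinj, pgWt]
    refine Set.ncard_le_ncard ?_ (Set.toFinite _)
    rintro _ ⟨y, hy, rfl⟩
    simpa using hy
  have hN0 : N 0 = s := by
    rw [hs_def, pgSecant, show N 0 = (Finset.univ.filter fun x : F =>
      pgEval c (x • r + u + ((0 : W) : Fin (n + 1) → F)) ≠ 0).card from rfl,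
      ← Set.ncard_coe_finset]
    refine Set.ncard_congr (fun x _ => pt (x, 0)) (fun x hx => ?_) (fun x x' _ _ h => ?_) ?_
    · refine ⟨?_, ?_⟩
      · rw [hpt]
        simpa using hx
      · rw [pgPoint_le_iff (hne x _ (0 : W).2) (hself (x, 0)), hl']
        exact ⟨x, 1, by simp⟩
    · exact (Prod.ext_iff.1 (hptinj h)).1
    · rintro P ⟨hcP, hPl⟩
      obtain ⟨v, hvP, hv0⟩ := pgPoint_exists_vector P
      obtain ⟨a, b, rfl⟩ := (hl' v).1 (hPl hvP)
      have hev := pgEval_eq c hv0 hvP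
      have hb : b ≠ 0 := by
        rintro rfl
        rw [zero_smul, add_zero] at hev hv0
        rw [pgEval_smul_right c (fun h => hv0 (by simp [h])), hr] at hev
        exact hcP hev.symm
      have hmem : (a / b) • r + u + ((0 : W) : Fin (n + 1) → F) ∈ P.1 := by
        have := P.1.smul_mem b⁻¹ hvP
        rw [smul_add, smul_smul, smul_smul, inv_mul_cancel₀ hb, one_smul] at this
        rwa [ZeroMemClass.coe_zero, add_zero, div_eq_inv_mul]
      have hx0 := hne (a / b) _ (0 : W).2
      refine ⟨a / b, ?_, (pgPoint_eq_span hx0 hmem).symm⟩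
      simp only [Finset.coe_filter, Finset.mem_univ, true_and, Set.mem_ofPred_eq]
      rwa [pgEval_eq c hx0 hmem]
  have hline : ∀ w : W, w ≠ 0 → (s : ℤ) * (Fintype.card F - s) ≤
      ∑ t ∈ Finset.univ.erase (0 : F), (N (t • w) : ℤ) := fun w _ => by
    have hmom := fun (j : ℕ) (hj : j < Fintype.card F - 1) =>
      exists_moment_polynomial (r := r) (u := u) (w := w) σ hc
        (fun x t => hne x _ (W.smul_mem t w.2)) hj
    have hmom' : ∀ j, ∃ M : Polynomial F, j < Fintype.card F - 1 → M.natDegree ≤ j ∧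
        ∀ t, M.eval t = ∑ x, σ (pgEval c (x • r + u + t • (w : Fin (n + 1) → F))) * x ^ j := by
      intro j
      by_cases hj : j < Fintype.card F - 1
      · obtain ⟨M, hM⟩ := hmom j hj
        exact ⟨M, fun _ => hM⟩
      · exact ⟨0, fun h => absurd h hj⟩
    choose M hM using hmom'
    have hσ : ∀ a, σ a ≠ 0 ↔ a ≠ 0 := fun a => map_ne_zero_iff σ hσinj
    have key := sum_tsub_card_support_le
      (fun t x => σ (pgEval c (x • r + u + t • (w : Fin (n + 1) → F)))) s M
      (fun j hj => (hM j (by omega)).1) (fun j hj => (hM j (by omega)).2) 0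
      (by rw [← hN0]; simp [hN, hσ])
    have hNt : ∀ t : F, (Finset.univ.filter fun x : F =>
        σ (pgEval c (x • r + u + t • (w : Fin (n + 1) → F))) ≠ 0).card = N (t • w) := fun t => by
      simp [hN, hσ]
    simp only [hNt] at key
    have h3 : ∑ t ∈ Finset.univ.erase (0 : F), ((s : ℤ) - N (t • w)) ≤ s * (s - 1 : ℕ) := by
      calc ∑ t ∈ Finset.univ.erase (0 : F), ((s : ℤ) - N (t • w))
          ≤ ∑ t ∈ Finset.univ.erase (0 : F), ((s - N (t • w) : ℕ) : ℤ) :=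
            Finset.sum_le_sum fun t _ => by omega
        _ ≤ ∑ t : F, ((s - N (t • w) : ℕ) : ℤ) :=
            Finset.sum_le_sum_of_subset_of_nonneg (Finset.subset_univ _) fun _ _ _ => by omega
        _ ≤ _ := by exact_mod_cast key
    rw [Finset.sum_sub_distrib, Finset.sum_const, Finset.card_erase_of_mem (Finset.mem_univ _),
      Finset.card_univ, nsmul_eq_mul, Nat.cast_sub hq.le, Nat.cast_one] at h3
    rcases Nat.eq_zero_or_pos s with h0 | h0
    · rw [h0, Nat.cast_zero, zero_mul]
      exact Finset.sum_nonneg fun t _ => Nat.cast_nonneg _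
    · rw [Nat.cast_sub h0] at h3
      push_cast at h3
      linarith
  have hav := card_sub_one_mul_le_sum_erase_zero (fun w : W => (N w : ℤ)) _ hline
  have htot : ((N 0 : ℕ) : ℤ) + ∑ w ∈ Finset.univ.erase (0 : W), (N w : ℤ) ≤ pgWt p F n c := by
    rw [Finset.add_sum_erase _ (fun w => (N w : ℤ)) (Finset.mem_univ _)]
    exact_mod_cast hsum
  have hcardW : (Fintype.card W : ℤ) = (Fintype.card F : ℤ) ^ (n - 1) := by
    rw [Module.card_eq_pow_finrank (K := F), show finrank F W = n - 1 by omega]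
    push_cast
    rfl
  rw [hcardW] at hav
  rw [hN0] at htot
  have hq' : (1 : ℤ) < Fintype.card F := by exact_mod_cast hq
  have := mul_le_mul_of_nonneg_left htot (sub_nonneg.2 hq'.le)
  rw [mul_add] at this
  linarith

omit [Fintype F] in
lemma finrank_add_finrank_le_finrank_inf_add {A B κ : Submodule F (Fin (n + 1) → F)}
    (hA : A ≤ κ) (hB : B ≤ κ) :
    finrank F A + finrank F B ≤ finrank F (A ⊓ B : Submodule F (Fin (n + 1) → F)) +
      finrank F κ := by
  have h1 := Submodule.finrank_sup_add_finrank_inf_eq A B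
  have h2 := Submodule.finrank_mono (sup_le hA hB)
  omega

omit [Fintype F] in
lemma finrank_inf_lt_of_ne {A B : Submodule F (Fin (n + 1) → F)}
    (h : finrank F A = finrank F B) (hne : A ≠ B) :
    finrank F (A ⊓ B : Submodule F (Fin (n + 1) → F)) < finrank F A := by
  refine Submodule.finrank_lt_finrank_of_lt (lt_of_le_of_ne inf_le_left fun h1 => hne ?_)
  exact Submodule.eq_of_le_of_finrank_eq (inf_eq_left.1 h1) h

/-- At most `q` proper subspaces do not cover a space. -/
lemma exists_mem_forall_notMem {d : ℕ} {κ : Submodule F (Fin (n + 1) → F)}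
    (hκ : finrank F κ = d + 1) {ι : Type*} [Fintype ι] (hι : Fintype.card ι ≤ Fintype.card F)
    (S : ι → Submodule F (Fin (n + 1) → F)) (hS : ∀ i, finrank F (S i) ≤ d) :
    ∃ v ∈ κ, ∀ i, v ∉ S i := by
  by_contra! h
  have hq : 1 < Fintype.card F := Fintype.one_lt_card
  have h1 : (Finset.univ.filter fun v => v ∈ κ ∧ v ≠ 0) ⊆
      Finset.univ.biUnion fun i => Finset.univ.filter fun v => v ∈ S i ∧ v ≠ 0 := fun v hv => by
    simp only [Finset.mem_filter, Finset.mem_univ, true_and, Finset.mem_biUnion] at hv ⊢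
    obtain ⟨i, hi⟩ := h v hv.1
    exact ⟨i, hi, hv.2⟩
  have h2 := (Finset.card_le_card h1).trans (Finset.card_biUnion_le_card_mul _ _
    (Fintype.card F ^ d - 1) fun i _ => by
      rw [card_filter_mem_ne_zero]
      exact Nat.sub_le_sub_right (Nat.pow_le_pow_right hq.le (hS i)) 1)
  rw [card_filter_mem_ne_zero, hκ, Finset.card_univ] at h2
  have h3 := h2.trans (Nat.mul_le_mul_right _ hι)
  rw [Nat.mul_sub, mul_one, ← pow_succ'] at h3
  have h4 := Nat.pow_le_pow_right hq.le (show 1 ≤ d + 1 by omega)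
  rw [pow_one] at h4
  generalize Fintype.card F ^ (d + 1) = Q at h3 h4
  omega

section Combination

variable {k s : ℕ} {κ : Submodule F (Fin (n + 1) → F)}
  {γ : Fin s → Submodule F (Fin (n + 1) → F)}

/-- If few hyperplanes of a space are given, some line of the space meets them in pairwise
different points. -/
lemma exists_transversal_line (hk : 1 ≤ k) (hκ : finrank F κ = k + 1)
    (hinj : Function.Injective γ) (hγ : ∀ i, γ i ≤ κ ∧ finrank F (γ i) = k)
    (hs : 2 ≤ k → s * s + 1 ≤ Fintype.card F) :
    ∃ l : Submodule F (Fin (n + 1) → F), finrank F l = 2 ∧ l ≤ κ ∧ (∀ i, ¬ l ≤ γ i) ∧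
      ∀ i j, i ≠ j → γ i ⊓ γ j ⊓ l = ⊥ := by
  obtain rfl | hk2 : k = 1 ∨ 2 ≤ k := by omega
  · refine ⟨κ, hκ, le_rfl, fun i h => ?_, fun i j hij => ?_⟩
    · have := Submodule.finrank_mono h
      rw [hκ, (hγ i).2] at this
      omega
    · have := finrank_inf_lt_of_ne ((hγ i).2.trans (hγ j).2.symm) (hinj.ne hij)
      rw [(hγ i).2, Nat.lt_one_iff, Submodule.finrank_eq_zero] at this
      rw [this, bot_inf_eq]
  specialize hs hk2
  obtain ⟨v, hvκ, hv⟩ := exists_mem_forall_notMem hκ (ι := Option (Fin s))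
    (by rw [Fintype.card_option, Fintype.card_fin]; nlinarith) (fun o => o.elim ⊥ γ)
    (by
      rintro (_ | i)
      · exact (finrank_bot F (Fin (n + 1) → F)).trans_le k.zero_le
      · exact (hγ i).2.le)
  have hv0 : v ≠ 0 := by simpa using hv none
  have hvγ : ∀ i, v ∉ γ i := fun i => hv (some i)
  have hspan := finrank_span_singleton (K := F) hv0
  obtain ⟨u, huκ, hu⟩ := exists_mem_forall_notMem hκ (ι := Option (Fin s × Fin s))
    (by simpa using hs)
    (fun o => o.elim (Submodule.span F {v}) fun y =>
      (if y.1 = y.2 then ⊥ else γ y.1 ⊓ γ y.2) ⊔ Submodule.span F {v})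
    (by
      rintro (_ | ⟨i, j⟩)
      · exact hspan.trans_le hk
      · refine (Submodule.finrank_add_le_finrank_add_finrank _ _).trans ?_
        rw [hspan]
        by_cases hij : i = j
        · rw [if_pos hij, finrank_bot]
          omega
        · rw [if_neg hij]
          change finrank F (γ i ⊓ γ j : Submodule F (Fin (n + 1) → F)) + 1 ≤ k
          have := finrank_inf_lt_of_ne ((hγ i).2.trans (hγ j).2.symm) (hinj.ne hij)
          rw [(hγ i).2] at this
          omega)
  have huv : u ∉ Submodule.span F {v} := hu none
  have hind : LinearIndependent F ![v, u] := by
    refine LinearIndependent.pair_iff.2 fun a b hab => ?_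
    have hb : b = 0 := by
      by_contra hb
      refine huv (((Submodule.span F {v}).smul_mem_iff hb).1 ?_)
      rw [← neg_eq_of_add_eq_zero_right hab]
      exact neg_mem (Submodule.smul_mem _ _ (Submodule.mem_span_singleton_self v))
    subst hb
    simpa [hv0] using hab
  refine ⟨Submodule.span F {v, u}, ?_, ?_, fun i h => ?_, fun i j hij => ?_⟩
  · rw [← Matrix.range_cons_cons_empty, finrank_span_eq_card hind, Fintype.card_fin]
  · rw [Submodule.span_le, Set.insert_subset_iff, Set.singleton_subset_iff]
    exact ⟨hvκ, huκ⟩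
  · exact hvγ i (h (Submodule.subset_span (by simp)))
  · rw [eq_bot_iff]
    rintro x ⟨hx, hxl⟩
    obtain ⟨a, b, rfl⟩ := Submodule.mem_span_pair.1 hxl
    have hb : b = 0 := by
      by_contra hb
      refine hu (some (i, j)) ?_
      simp only [Option.elim_some, if_neg hij]
      refine (Submodule.smul_mem_iff _ hb).1 (Submodule.mem_sup.2
        ⟨_, hx, -(a • v), neg_mem (Submodule.smul_mem _ _ (Submodule.mem_span_singleton_self v)),
          by abel⟩)
    subst hb
    rw [zero_smul, add_zero] at hx ⊢
    have ha : a = 0 := by_contra fun ha => hvγ i (((γ i).smul_mem_iff ha).1 hx.1)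
    simp [ha]

variable {c : PGPoint F n → ZMod p} {β : Fin s → ZMod p}

omit [Fintype F] in
lemma pgEval_eq_sum
    (hc : ∀ P : PGPoint F n, P.1 ≤ κ → c P = ∑ i, β i * pgInd p F n (γ i) P)
    {v : Fin (n + 1) → F} (hv : v ∈ κ) (hv0 : v ≠ 0) :
    pgEval c v = ∑ i, if v ∈ γ i then β i else 0 := by
  have hself := Submodule.mem_span_singleton_self (R := F) v
  rw [pgEval_eq c (P := ⟨Submodule.span F {v}, finrank_span_singleton hv0⟩) hv0 hself,
    hc _ ((pgPoint_le_iff hv0 hself).2 hv)]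
  refine Finset.sum_congr rfl fun i _ => ?_
  simp only [pgInd, Submodule.span_singleton_le_iff_mem, mul_ite, mul_one, mul_zero]

lemma card_filter_mem_inf_ne_zero_le {l g : Submodule F (Fin (n + 1) → F)}
    (hl : finrank F l = 2) (hg : ¬ l ≤ g) :
    (Finset.univ.filter fun v => v ∈ g ⊓ l ∧ v ≠ 0).card ≤ Fintype.card F - 1 := by
  rw [card_filter_mem_ne_zero]
  have h1 : finrank F (g ⊓ l : Submodule F (Fin (n + 1) → F)) < 2 := by
    rw [← hl]
    exact Submodule.finrank_lt_finrank_of_lt (lt_of_le_of_ne inf_le_right (by simpa using hg))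
  refine Nat.sub_le_sub_right ((Nat.pow_le_pow_right Fintype.card_pos
    (Nat.le_of_lt_succ h1)).trans (pow_one _).le) 1

lemma pgSecant_line_le_or
    (hc : ∀ P : PGPoint F n, P.1 ≤ κ → c P = ∑ i, β i * pgInd p F n (γ i) P)
    {l : Submodule F (Fin (n + 1) → F)} (hl : finrank F l = 2) (hlκ : l ≤ κ) :
    pgSecant p F n c l ≤ s ∨
      (∃ i, l ≤ γ i) ∧ Fintype.card F + 1 ≤ s + pgSecant p F n c l := by
  have hq : 0 < Fintype.card F - 1 := Nat.sub_pos_of_lt Fintype.one_lt_card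
  set T := Finset.univ.filter fun i => ¬ l ≤ γ i with hT
  set B := T.biUnion fun i => Finset.univ.filter fun v => v ∈ γ i ⊓ l ∧ v ≠ 0 with hB
  set b := ∑ i, if l ≤ γ i then β i else 0 with hb
  have hBcard : B.card ≤ s * (Fintype.card F - 1) := by
    refine (Finset.card_biUnion_le_card_mul _ _ (Fintype.card F - 1) fun i hi =>
      card_filter_mem_inf_ne_zero_le hl (Finset.mem_filter.1 hi).2).trans ?_
    refine Nat.mul_le_mul_right _ ((Finset.card_filter_le _ _).trans ?_)
    simp
  have hoff : ∀ v ∈ l, v ≠ 0 → v ∉ B → pgEval c v = b := fun v hv hv0 hvB => by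
    rw [pgEval_eq_sum hc (hlκ hv) hv0, hb]
    refine Finset.sum_congr rfl fun i _ => if_congr ⟨fun hvi => ?_, fun h => h hv⟩ rfl rfl
    by_contra hli
    refine hvB (Finset.mem_biUnion.2 ⟨i, by simpa [hT] using hli, ?_⟩)
    simpa using ⟨⟨hvi, hv⟩, hv0⟩
  have hsec := pgSecant_mul_card_sub_one c l
  by_cases hb0 : b = 0
  · left
    refine Nat.le_of_mul_le_mul_right ?_ hq
    rw [hsec]
    refine (Finset.card_le_card fun v hv => ?_).trans hBcard
    simp only [Finset.mem_filter, Finset.mem_univ, true_and] at hv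
    by_contra hvB
    have hv0 : v ≠ 0 := by rintro rfl; simp at hv
    exact hv.2 (by rw [hoff v hv.1 hv0 hvB, hb0])
  · right
    refine ⟨?_, Nat.le_of_mul_le_mul_right ?_ hq⟩
    · by_contra! h
      exact hb0 (Finset.sum_eq_zero fun i _ => if_neg (h i))
    rw [add_mul s, hsec]
    have h1 : (Finset.univ.filter fun v => v ∈ l ∧ v ≠ 0) ⊆
        B ∪ Finset.univ.filter fun v => v ∈ l ∧ pgEval c v ≠ 0 := fun v hv => by
      simp only [Finset.mem_filter, Finset.mem_univ, true_and, Finset.mem_union] at hv ⊢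
      by_cases hvB : v ∈ B
      · exact Or.inl hvB
      · exact Or.inr ⟨hv.1, by rwa [hoff v hv.1 hv.2 hvB]⟩
    have h2 := (Finset.card_le_card h1).trans (Finset.card_union_le _ _)
    rw [card_filter_mem_ne_zero, hl] at h2
    have h3 : (Fintype.card F + 1) * (Fintype.card F - 1) = Fintype.card F ^ 2 - 1 := by
      rw [← Nat.sq_sub_sq, one_pow]
    rw [h3]
    exact h2.trans (Nat.add_le_add_right hBcard _)

lemma le_pgSecant_of_transversal (hκ : finrank F κ = k + 1)
    (hγ : ∀ i, γ i ≤ κ ∧ finrank F (γ i) = k) (hβ : ∀ i, β i ≠ 0)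
    (hc : ∀ P : PGPoint F n, P.1 ≤ κ → c P = ∑ i, β i * pgInd p F n (γ i) P)
    {l : Submodule F (Fin (n + 1) → F)} (hl : finrank F l = 2) (hlκ : l ≤ κ)
    (hlγ : ∀ i j, i ≠ j → γ i ⊓ γ j ⊓ l = ⊥) :
    s ≤ pgSecant p F n c l := by
  have hq : 0 < Fintype.card F - 1 := Nat.sub_pos_of_lt Fintype.one_lt_card
  refine Nat.le_of_mul_le_mul_right ?_ hq
  rw [pgSecant_mul_card_sub_one]
  have huniq : ∀ i j v, v ∈ γ i → v ∈ γ j → v ∈ l → v ≠ 0 → i = j :=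
    fun i j v hi hj hvl hv0 => by
      by_contra hij
      have : v ∈ γ i ⊓ γ j ⊓ l := ⟨⟨hi, hj⟩, hvl⟩
      rw [hlγ i j hij] at this
      exact hv0 (by simpa using this)
  have hsub : (Finset.univ.biUnion fun i => Finset.univ.filter fun v => v ∈ γ i ⊓ l ∧ v ≠ 0) ⊆
      Finset.univ.filter fun v => v ∈ l ∧ pgEval c v ≠ 0 := fun v hv => by
    simp only [Finset.mem_biUnion, Finset.mem_filter, Finset.mem_univ, true_and,
      Submodule.mem_inf] at hv ⊢
    obtain ⟨i, ⟨hvi, hvl⟩, hv0⟩ := hv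
    refine ⟨hvl, ?_⟩
    rw [pgEval_eq_sum hc (hlκ hvl) hv0, Finset.sum_eq_single i]
    · rw [if_pos hvi]
      exact hβ i
    · intro j _ hji
      exact if_neg fun hvj => hji (huniq j i v hvj hvi hvl hv0)
    · simp
  refine le_trans ?_ (Finset.card_le_card hsub)
  rw [Finset.card_biUnion]
  · calc s * (Fintype.card F - 1) = ∑ _i : Fin s, (Fintype.card F - 1) := by simp
      _ ≤ _ := Finset.sum_le_sum fun i _ => by
        rw [card_filter_mem_ne_zero]
        have h1 := finrank_add_finrank_le_finrank_inf_add (hγ i).1 hlκ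
        rw [(hγ i).2, hl, hκ] at h1
        refine Nat.sub_le_sub_right ?_ 1
        calc Fintype.card F = Fintype.card F ^ 1 := (pow_one _).symm
          _ ≤ _ := Nat.pow_le_pow_right Fintype.card_pos (by omega)
  · intro i _ j _ hij
    refine Finset.disjoint_left.2 fun v hv hv' => hij ?_
    simp only [Finset.mem_filter, Finset.mem_univ, true_and] at hv hv'
    exact huniq i j v hv.1.1 hv'.1.1 hv.1.2 hv.2

lemma pgSecant_mul_le (hk : 1 ≤ k) (hκ : finrank F κ = k + 1)
    (hγ : ∀ i, γ i ≤ κ ∧ finrank F (γ i) = k)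
    (hc : ∀ P : PGPoint F n, P.1 ≤ κ → c P = ∑ i, β i * pgInd p F n (γ i) P) :
    (pgSecant p F n c κ : ℤ) * ((Fintype.card F : ℤ) - 1) ≤
      s * ((Fintype.card F : ℤ) ^ k - (Fintype.card F : ℤ) ^ (k - 1)) +
        (Fintype.card F : ℤ) ^ (k - 1) - 1 := by
  have hq : 1 < Fintype.card F := Fintype.one_lt_card
  have hcover : ∀ v ∈ κ, pgEval c v ≠ 0 → v ≠ 0 ∧ ∃ i, v ∈ γ i := fun v hv hcv => by
    have hv0 : v ≠ 0 := by rintro rfl; simp at hcv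
    refine ⟨hv0, ?_⟩
    by_contra! h
    refine hcv ?_
    rw [pgEval_eq_sum hc hv hv0]
    exact Finset.sum_eq_zero fun i _ => if_neg (h i)
  have hsec := pgSecant_mul_card_sub_one c κ
  rw [← Nat.cast_pred hq.le, ← Nat.cast_mul, hsec]
  obtain rfl | ⟨m, rfl⟩ : s = 0 ∨ ∃ m, s = m + 1 := by cases s <;> simp
  · rw [Finset.filter_eq_empty_iff.2 fun v _ h => (hcover v h.1 h.2).2.elim fun i _ => i.elim0]
    have : (1 : ℤ) ≤ (Fintype.card F : ℤ) ^ (k - 1) := one_le_pow₀ (by exact_mod_cast hq.le)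
    simpa using this
  · have hsub : (Finset.univ.filter fun v => v ∈ κ ∧ pgEval c v ≠ 0) ⊆
        (Finset.univ.filter fun v => v ∈ γ 0 ∧ v ≠ 0) ∪
        Finset.univ.biUnion fun i : Fin m =>
          (Finset.univ.filter (· ∈ γ i.succ)) \ Finset.univ.filter (· ∈ γ i.succ ⊓ γ 0) :=
      fun v hv => by
        simp only [Finset.mem_filter, Finset.mem_univ, true_and, Finset.mem_union,
          Finset.mem_biUnion, Finset.mem_sdiff, Submodule.mem_inf] at hv ⊢
        obtain ⟨hv0, i, hi⟩ := hcover v hv.1 hv.2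
        by_cases h0 : v ∈ γ 0
        · exact Or.inl ⟨h0, hv0⟩
        · right
          obtain ⟨j, rfl⟩ : ∃ j : Fin m, i = j.succ :=
            Fin.exists_succ_eq.2 (by rintro rfl; exact h0 hi) |>.imp fun _ h => h.symm
          exact ⟨j, hi, fun h => h0 h.2⟩
    have h1 := (Finset.card_le_card hsub).trans ((Finset.card_union_le _ _).trans
      (Nat.add_le_add_left (Finset.card_biUnion_le_card_mul _ _
        (Fintype.card F ^ k - Fintype.card F ^ (k - 1)) fun i _ => ?_) _))
    · rw [card_filter_mem_ne_zero, (hγ 0).2, Finset.card_univ, Fintype.card_fin] at h1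
      have hle : Fintype.card F ^ (k - 1) ≤ Fintype.card F ^ k :=
        Nat.pow_le_pow_right hq.le (by omega)
      have h2 : ((Fintype.card F ^ k - 1 + m * (Fintype.card F ^ k - Fintype.card F ^ (k - 1)) :
          ℕ) : ℤ) = (Fintype.card F : ℤ) ^ k - 1 +
            m * ((Fintype.card F : ℤ) ^ k - (Fintype.card F : ℤ) ^ (k - 1)) := by
        rw [Nat.cast_add, Nat.cast_mul, Nat.cast_sub hle, Nat.cast_sub (Nat.one_le_pow _ _ hq.le)]
        push_cast
        rfl
      have h3 := (Nat.cast_le (α := ℤ)).2 h1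
      rw [h2] at h3
      push_cast
      linarith
    · rw [Finset.card_sdiff_of_subset fun v hv => by
          simp only [Finset.mem_filter, Finset.mem_univ, true_and, Submodule.mem_inf] at hv ⊢
          exact hv.1,
        card_filter_mem, card_filter_mem, (hγ _).2]
      refine Nat.sub_le_sub_left (Nat.pow_le_pow_right hq.le ?_) _
      have := finrank_add_finrank_le_finrank_inf_add (hγ i.succ).1 (hγ 0).1
      rw [(hγ _).2, (hγ _).2, hκ] at this
      omega

end Combination

end pgEval

section Numerics

variable {p h : ℕ}

lemma pgDelta_nonneg (i : ℤ) : 0 ≤ pgDelta p h i := by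
  unfold pgDelta
  split_ifs <;> exact Int.floor_nonneg.2 (by positivity)

lemma pgDelta_anti {i j : ℤ} (hij : i ≤ j) : pgDelta p h j ≤ pgDelta p h i := by
  unfold pgDelta
  split_ifs
  · refine Int.floor_le_floor (div_le_div_of_nonneg_left (by positivity) (by positivity) ?_)
    exact zpow_le_zpow_right₀ one_le_two (by omega)
  · refine Int.floor_le_floor (div_le_div_of_nonneg_left (by positivity) (by positivity) ?_)
    exact zpow_le_zpow_right₀ one_le_two hij

lemma pgDelta_sq_mul_le (hh : 2 ≤ h) (i : ℕ) :
    pgDelta p h i ^ 2 * 4 ^ i ≤ 16 * ((p ^ h : ℕ) : ℤ) := by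
  have hfloor : ∀ x : ℝ, 0 ≤ x → ((⌊x⌋ : ℤ) : ℝ) ^ 2 ≤ x ^ 2 := fun x hx =>
    pow_le_pow_left₀ (by exact_mod_cast Int.floor_nonneg.2 hx) (Int.floor_le x) 2
  have h4 : ((2 : ℝ) ^ (i : ℤ)) ^ 2 = 4 ^ i := by
    rw [zpow_natCast, ← pow_mul, mul_comm, pow_mul]
    norm_num
  have key : (pgDelta p h i : ℝ) ^ 2 * 4 ^ i ≤ 16 * (p : ℝ) ^ h := by
    unfold pgDelta
    split_ifs with h2
    · refine (mul_le_mul_of_nonneg_right (hfloor _ (by positivity)) (by positivity)).trans ?_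
      rw [div_pow, Real.sq_sqrt (by positivity), zpow_sub₀ two_ne_zero, div_pow, h4]
      apply le_of_eq
      field_simp
      norm_num
    · obtain rfl : h = 2 := by omega
      refine (mul_le_mul_of_nonneg_right (hfloor _ (by positivity)) (by positivity)).trans ?_
      rw [div_pow, h4, div_mul_cancel₀ _ (by positivity)]
      nlinarith [sq_nonneg (p : ℝ)]
  exact_mod_cast key

lemma sub_one_mul_pgTheta (q k : ℕ) :
    ((q : ℤ) - 1) * pgTheta q ((k : ℤ) - 1) = (q : ℤ) ^ k - 1 := by
  rw [pgTheta, sub_add_cancel, Int.toNat_natCast, mul_geom_sum]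

lemma pgTheta_pos (q : ℕ) {k : ℕ} (hk : 1 ≤ k) : 0 < pgTheta q ((k : ℤ) - 1) := by
  rw [pgTheta, sub_add_cancel, Int.toNat_natCast]
  exact Finset.sum_pos' (fun _ _ => by positivity) ⟨0, Finset.mem_range.2 hk, by simp⟩

lemma le_sub_one_of_le_pgCeil {q k w s : ℕ} (hk : 1 ≤ k) {D : ℤ}
    (hw : (w : ℤ) ≤ (D - 1) * pgTheta q ((k : ℤ) - 1)) (hs : s ≤ pgCeil q w ((k : ℤ) - 1)) :
    (s : ℤ) ≤ D - 1 := by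
  have hθ := pgTheta_pos q hk
  have hD : 0 ≤ D - 1 := by
    by_contra! h
    have := mul_neg_of_neg_of_pos h hθ
    omega
  have hceil : ⌈(w : ℚ) / ((pgTheta q ((k : ℤ) - 1) : ℤ) : ℚ)⌉ ≤ D - 1 := by
    rw [Int.ceil_le, div_le_iff₀ (by exact_mod_cast hθ)]
    exact_mod_cast hw
  rw [pgCeil] at hs
  omega

/-- A quadratic lower bound on `w` excludes values of `s` between `D` and about `2 * √Q`. -/
lemma le_of_quadratic_bound {Q T D E s w : ℤ} (hQ : 32 ≤ Q) (hT : 1 ≤ T) (hD : 4 * D ^ 2 ≤ Q)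
    (hD0 : 0 ≤ D) (hE : E ^ 2 ≤ 4 * Q) (hs0 : 0 ≤ s) (hsE : s ≤ E - 1)
    (h : (Q - 1) * s + (T - 1) * (s * (Q - s)) ≤ (Q - 1) * w)
    (hw : (Q - 1) * w ≤ (D - 1) * (Q * T - 1)) : s ≤ D := by
  by_contra! hDs
  have hsq : s ^ 2 ≤ (s - D + 1) * Q := by
    by_cases h3 : D + 3 ≤ s
    · nlinarith
    · have h4 : s ^ 2 ≤ 2 * Q := by nlinarith [sq_nonneg (D - 2)]
      nlinarith
  have h5 : (D - 1) * Q ≤ s * (Q - s) := by nlinarith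
  have h6 := mul_le_mul_of_nonneg_left h5 (sub_nonneg.2 hT)
  nlinarith

end Numerics

/-- Lemma: if a thin `k`-space `κ` admits a representation of `c|_κ` as a combination
of at most `⌈wt(c|_κ)/θ_{k−1}⌉` different `(k−1)`-subspaces, then `c|_κ` is a
combination of precisely `m_κ` such subspaces, and
`wt(c|_κ) ≤ m_κ·q^(k−1) + θ_{k−2} ≤ Δ_{n,q}·q^(k−1) + θ_{k−2}`. -/
theorem statement_5 (p h n : ℕ) (hp : p.Prime) (hh : 2 ≤ h) (hn : 3 ≤ n)
    (hq1 : 2 < h → max 32 (2 ^ (2 * n - 4)) ≤ p ^ h)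
    (hq2 : h = 2 → 2 ^ (2 * n) ≤ p ^ h)
    (F : Type) [Field F] [Fintype F] (hF : Fintype.card F = p ^ h)
    (c : PGPoint F n → ZMod p) (hc : c ∈ pgCode p F n)
    (hwt : (pgWt p F n c : ℤ) ≤ pgW p h n)
    (k : ℕ) (hk1 : 1 ≤ k) (hkn : k ≤ n)
    (κ : Submodule F (Fin (n + 1) → F)) (hκdim : finrank F κ = k + 1)
    (hκthin : (pgSecant p F n c κ : ℤ) ≤ pgW p h k)
    (hrep : ∃ s : ℕ, s ≤ pgCeil (p ^ h) (pgSecant p F n c κ) ((k : ℤ) - 1) ∧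
      ∃ (γ : Fin s → Submodule F (Fin (n + 1) → F)) (β : Fin s → ZMod p),
        Function.Injective γ ∧ (∀ i, γ i ≤ κ ∧ finrank F (γ i) = k) ∧
        (∀ i, β i ≠ 0) ∧
        ∀ P : PGPoint F n, P.1 ≤ κ → c P = ∑ i, β i * pgInd p F n (γ i) P) :
    let mκ := sSup {a : ℕ | ∃ l : Submodule F (Fin (n + 1) → F),
      finrank F l = 2 ∧ l ≤ κ ∧ pgSecant p F n c l = a ∧ (a : ℤ) ≤ pgW p h 1}
    (∃ (γ : Fin mκ → Submodule F (Fin (n + 1) → F)) (β : Fin mκ → ZMod p),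
        Function.Injective γ ∧ (∀ i, γ i ≤ κ ∧ finrank F (γ i) = k) ∧
        (∀ i, β i ≠ 0) ∧
        ∀ P : PGPoint F n, P.1 ≤ κ → c P = ∑ i, β i * pgInd p F n (γ i) P) ∧
    (pgSecant p F n c κ : ℤ) ≤
      (mκ : ℤ) * pgQpow (p ^ h) ((k : ℤ) - 1) + pgTheta (p ^ h) ((k : ℤ) - 2) ∧
    (mκ : ℤ) * pgQpow (p ^ h) ((k : ℤ) - 1) + pgTheta (p ^ h) ((k : ℤ) - 2) ≤
      pgDelta p h n * pgQpow (p ^ h) ((k : ℤ) - 1) + pgTheta (p ^ h) ((k : ℤ) - 2) := by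
  intro mκ
  have hq32 : 32 ≤ p ^ h := by
    obtain h2 | h2 : h = 2 ∨ 2 < h := by omega
    · exact le_trans (le_trans (by norm_num) (Nat.pow_le_pow_right two_pos
        (show 6 ≤ 2 * n by omega))) (hq2 h2)
    · exact (le_max_left _ _).trans (hq1 h2)
  have : Fact p.Prime := ⟨hp⟩
  have : CharP F p := by
    obtain ⟨r, hr⟩ := CharP.exists F
    obtain ⟨m, hr', hm⟩ := FiniteField.card F r
    rw [hF] at hm
    obtain rfl : r = p := (Nat.prime_dvd_prime_iff_eq hr' hp).1
      (hr'.dvd_of_dvd_pow (hm ▸ dvd_pow_self r m.pos.ne'))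
    exact hr
  set q := p ^ h with hq
  have hqZ : (32 : ℤ) ≤ q := by exact_mod_cast hq32
  have hΔ1 := pgDelta_sq_mul_le (p := p) hh 1
  have hΔk := pgDelta_sq_mul_le (p := p) hh k
  have hΔn := pgDelta_sq_mul_le (p := p) hh n
  rw [← hq] at hΔ1 hΔk hΔn
  have hΔk0 := pgDelta_nonneg (p := p) (h := h) k
  have hΔn0 := pgDelta_nonneg (p := p) (h := h) n
  have hΔk1 : pgDelta p h k ≤ pgDelta p h (1 : ℕ) := pgDelta_anti (by exact_mod_cast hk1)
  have hW1 : pgW p h 1 = pgDelta p h (1 : ℕ) - 1 := by simp [pgW, pgTheta]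
  obtain ⟨s, hs, γ, β, hinj, hγ, hβ, hcκ⟩ := hrep
  have hsΔ : (s : ℤ) ≤ pgDelta p h k - 1 := le_sub_one_of_le_pgCeil hk1 hκthin hs
  have h2E : 2 * (pgDelta p h (1 : ℕ) - 1) ≤ q := by
    by_contra! hlt
    nlinarith
  have hss : 2 ≤ k → s * s + 1 ≤ Fintype.card F := fun hk2 => by
    have h16 : (16 : ℤ) ≤ 4 ^ k := le_trans (by norm_num) (pow_le_pow_right₀ (by norm_num) hk2)
    have : pgDelta p h k ^ 2 ≤ q := by nlinarith [sq_nonneg (pgDelta p h k)]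
    rw [hF]
    zify
    nlinarith
  obtain ⟨l, hl, hlκ, hlγ, hlγγ⟩ := exists_transversal_line hk1 hκdim hinj hγ hss
  have hline : ∀ l' : Submodule F (Fin (n + 1) → F), finrank F l' = 2 → l' ≤ κ →
      pgSecant p F n c l' ≤ s ∨ (∃ i, l' ≤ γ i) ∧ q + 1 ≤ s + pgSecant p F n c l' :=
    fun l' h1 h2 => hF ▸ pgSecant_line_le_or hcκ h1 h2
  have hls : pgSecant p F n c l = s :=
    le_antisymm ((hline l hl hlκ).resolve_right fun h => h.1.elim hlγ)
      (le_pgSecant_of_transversal hκdim hγ hβ hcκ hl hlκ hlγγ)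
  have hm : mκ = s := by
    refine IsGreatest.csSup_eq ⟨⟨l, hl, hlκ, hls, by omega⟩, ?_⟩
    rintro _ ⟨l', h1, h2, rfl, h3⟩
    refine (hline l' h1 h2).resolve_right fun h => ?_
    have := h.2
    omega
  clear_value mκ
  subst hm
  have hpow : pgQpow q ((k : ℤ) - 1) = (q : ℤ) ^ (k - 1) := by
    rw [pgQpow, if_neg (by omega)]
    congr 1
    omega
  have hθ : ((q : ℤ) - 1) * pgTheta q ((k : ℤ) - 2) = (q : ℤ) ^ (k - 1) - 1 := by
    rw [← sub_one_mul_pgTheta, Nat.cast_sub hk1]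
    congr 2
    push_cast
    ring
  refine ⟨⟨γ, β, hinj, hγ, hβ, hcκ⟩, ?_, ?_⟩
  · have h1 := pgSecant_mul_le hk1 hκdim hγ hcκ
    rw [hF] at h1
    have h2 : (q : ℤ) ^ k = q * (q : ℤ) ^ (k - 1) := by
      rw [← pow_succ', Nat.sub_add_cancel hk1]
    rw [hpow]
    refine le_of_mul_le_mul_right ?_ (show (0 : ℤ) < q - 1 by omega)
    rw [h2] at h1
    linarith
  · have h1 := le_pgWt_of_line (RingHom.injective (ZMod.castHom (dvd_refl p) F)) hc hl
      (by rw [hls, hF]; omega)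
    rw [hls, hF] at h1
    have hθn := sub_one_mul_pgTheta q n
    have h2 : (q : ℤ) ^ n = q * (q : ℤ) ^ (n - 1) := by
      rw [← pow_succ', Nat.sub_add_cancel (by omega)]
    have h64 : (64 : ℤ) ≤ 4 ^ n := le_trans (by norm_num) (pow_le_pow_right₀ (by norm_num) hn)
    have hD : 4 * pgDelta p h n ^ 2 ≤ q := by nlinarith [sq_nonneg (pgDelta p h n)]
    have hw : ((q : ℤ) - 1) * pgWt p F n c ≤
        (pgDelta p h n - 1) * (q * (q : ℤ) ^ (n - 1) - 1) := by
      rw [← h2, ← hθn, mul_left_comm]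
      exact mul_le_mul_of_nonneg_left hwt (by omega)
    have hsn := le_of_quadratic_bound hqZ (one_le_pow₀ (show (1 : ℤ) ≤ q by omega)) hD hΔn0
      (E := pgDelta p h (1 : ℕ)) (by linarith) (Int.natCast_nonneg _) (by omega) h1 hw
    rw [hpow]
    gcongr
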